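/- arXiv:1605.02520 — 5 statements merged into one kernel-verified Lean document; each statement's English description precedes it below -/
import Mathlib

section
/- Let $n \ge 1$, $1 < p < \infty$, and $\alpha, \beta \in \mathbb{R}$, with $\gamma = \alpha + \beta + 1$. Then for every smooth compactly supported function $f : \mathbb{R}^n \to \mathbb{C}$ vanishing near the origin, $$\frac{|n-\gamma|}{p} \int_{\mathbb{R}^n} \frac{|f(x)|^p}{\|x\|^{\gamma}}\,dx \le \left(\int_{\mathbb{R}^n} \frac{|\nabla f(x)|^p}{\|x\|^{\alpha p}}\,dx\right)^{1/p} \left(\int_{\mathbb{R}^n} \frac{|f(x)|^p}{\|x\|^{\beta p/(p-1)}}\,dx\right)^{(p-1)/p},$$ where $\|x\|$ is the Euclidean norm. -/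
open MeasureTheory Real

lemma aux_cont {E : Type*} [NormedAddCommGroup E] (K : Set E) (hK : IsClosed K) (h0 : (0 : E) ∉ K)
    (u : E → ℝ) (hu : Continuous u) (hv : ∀ x, x ∉ K → u x = 0) (s : ℝ) :
    Continuous (fun x => u x * ‖x‖ ^ s) := by
  rw [continuous_iff_continuousAt]
  intro x
  by_cases hx : x ∈ K
  · have hx0 : x ≠ 0 := fun h => h0 (h ▸ hx)
    exact hu.continuousAt.mul (continuousAt_id.norm.rpow_const (Or.inl (by simpa using hx0)))
  · have : (fun x => u x * ‖x‖ ^ s) =ᶠ[nhds x] fun _ => 0 := by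
      filter_upwards [hK.isOpen_compl.mem_nhds hx] with y hy
      rw [hv y hy, zero_mul]
    exact continuousAt_const.congr this.symm

lemma aux_supp {E : Type*} [NormedAddCommGroup E] (K : Set E) (hK : IsCompact K)
    (u : E → ℝ) (hv : ∀ x, x ∉ K → u x = 0) (s : ℝ) :
    HasCompactSupport (fun x => u x * ‖x‖ ^ s) := 
  HasCompactSupport.intro hK (fun x hx => by rw [hv x hx, zero_mul])

lemma aux_contDiff {E : Type*} [NormedAddCommGroup E] [InnerProductSpace ℝ E]
    (K : Set E) (hK : IsClosed K) (h0 : (0 : E) ∉ K)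
    (u : E → ℝ) (hu : ContDiff ℝ 1 u) (hv : ∀ x, x ∉ K → u x = 0) (s : ℝ) :
    ContDiff ℝ 1 (fun x => u x * ‖x‖ ^ s) := by
  rw [contDiff_iff_contDiffAt]
  intro x
  by_cases hx : x ∈ K
  · have hx0 : x ≠ 0 := fun h => h0 (h ▸ hx)
    exact hu.contDiffAt.mul ((contDiffAt_norm ℝ hx0).rpow_const_of_ne (by simpa using hx0))
  · have : (fun x => u x * ‖x‖ ^ s) =ᶠ[nhds x] fun _ => 0 := by
      filter_upwards [hK.isOpen_compl.mem_nhds hx] with y hy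
      rw [hv y hy, zero_mul]
    exact contDiffAt_const.congr_of_eventuallyEq this

lemma aux_euler {E : Type*} [NormedAddCommGroup E] [InnerProductSpace ℝ E]
    (u : E → ℝ) (hu : Differentiable ℝ u) (h0 : u 0 = 0) (s : ℝ) (x : E) :
    fderiv ℝ (fun x => u x * ‖x‖ ^ s) x x =
      fderiv ℝ u x x * ‖x‖ ^ s + s * (u x * ‖x‖ ^ s) := by
  by_cases hx : x = 0
  · subst hx; simp [h0]
  · have hd : DifferentiableAt ℝ (fun x : E => ‖x‖) x :=
      (contDiffAt_norm ℝ hx (n := 1)).differentiableAt one_ne_zero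
    have h1 := hd.hasFDerivAt.rpow_const (p := s) (Or.inl (by simpa using hx))
    have h2 := (hu x).hasFDerivAt.mul h1
    have h3 : fderiv ℝ (fun x : E => ‖x‖) x x = ‖x‖ := hd.fderiv_norm_self
    have h4 : ‖x‖ ^ (s - 1) * ‖x‖ = ‖x‖ ^ s := by
      rw [← rpow_add_one (by simpa using hx)]; simp
    have h5 : fderiv ℝ (fun x => u x * ‖x‖ ^ s) x = _ := h2.fderiv
    rw [h5]
    simp only [add_apply, smul_apply, smul_eq_mul, h3]
    rw [← h4]; ring

lemma aux_div (n : ℕ) (g : EuclideanSpace ℝ (Fin n) → ℝ) (hg : ContDiff ℝ 1 g)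
    (hs : HasCompactSupport g) :
    ∫ x, fderiv ℝ g x x = - (n * ∫ x, g x) := by
  have hc : ∀ i : Fin n, Continuous fun x : EuclideanSpace ℝ (Fin n) => x i := fun i => by fun_prop
  have hdc : ∀ v, Continuous fun x => fderiv ℝ g x v := fun v =>
    (hg.continuous_fderiv one_ne_zero).clm_apply continuous_const
  have hds : ∀ v, HasCompactSupport fun x => fderiv ℝ g x v := fun v =>
    hs.fderiv_apply (𝕜 := ℝ) v
  have hI : ∀ i : Fin n, Integrable fun x : EuclideanSpace ℝ (Fin n) =>
      x i * fderiv ℝ g x (EuclideanSpace.single i 1) := fun i =>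
    ((hc i).mul (hdc _)).integrable_of_hasCompactSupport ((hds _).mul_left)
  have hgI : Integrable g := hg.continuous.integrable_of_hasCompactSupport hs
  have hfd : ∀ (i : Fin n) (x : EuclideanSpace ℝ (Fin n)),
      fderiv ℝ (fun x : EuclideanSpace ℝ (Fin n) => x i) x (EuclideanSpace.single i 1) = 1 := by
    intro i x
    have : HasFDerivAt (fun x : EuclideanSpace ℝ (Fin n) => x i)
      (EuclideanSpace.proj (𝕜 := ℝ) i : EuclideanSpace ℝ (Fin n) →L[ℝ] ℝ) x :=
      (EuclideanSpace.proj (𝕜 := ℝ) i : EuclideanSpace ℝ (Fin n) →L[ℝ] ℝ).hasFDerivAt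
    rw [this.fderiv]; simp
  have key : ∀ i : Fin n, ∫ x : EuclideanSpace ℝ (Fin n),
      x i * fderiv ℝ g x (EuclideanSpace.single i 1) = - ∫ x, g x := by
    intro i
    have := integral_mul_fderiv_eq_neg_fderiv_mul_of_integrable (μ := volume)
      (f := fun x : EuclideanSpace ℝ (Fin n) => x i) (g := g) (v := EuclideanSpace.single i 1)
      (by simpa only [hfd, one_mul] using hgI) (hI i)
      (((hc i).mul hg.continuous).integrable_of_hasCompactSupport hs.mul_left)
      (fun x _ => by fun_prop) (fun x _ => (hg.differentiable one_ne_zero) x)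
    simpa only [hfd, one_mul] using this
  have hx : ∀ x : EuclideanSpace ℝ (Fin n), fderiv ℝ g x x =
      ∑ i, x i * fderiv ℝ g x (EuclideanSpace.single i 1) := by
    intro x
    have h := (EuclideanSpace.basisFun (Fin n) ℝ).sum_repr x
    have h' := congrArg (fderiv ℝ g x) h
    rw [map_sum] at h'
    rw [← h']
    simp
  simp_rw [hx]
  rw [integral_finsetSum _ (fun i _ => hI i)]
  simp [key]

theorem stmt0 (n : ℕ) (hn : 1 ≤ n) (p α β γ : ℝ) (hp1 : 1 < p)
    (hγ : γ = α + β + 1)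
    (f : EuclideanSpace ℝ (Fin n) → ℂ)
    (hf : ContDiff ℝ (⊤ : ℕ∞) f) (hsupp : HasCompactSupport f)
    (h0 : (0 : EuclideanSpace ℝ (Fin n)) ∉ tsupport f) :
    |(n : ℝ) - γ| / p * ∫ x, ‖f x‖ ^ p / ‖x‖ ^ γ ≤
      (∫ x, ‖fderiv ℝ f x‖ ^ p / ‖x‖ ^ (α * p)) ^ (1 / p) *
        (∫ x, ‖f x‖ ^ p / ‖x‖ ^ (β * p / (p - 1))) ^ ((p - 1) / p) := by
  have hp0 : 0 < p := by linarith
  have hp2 : 0 < p - 1 := by linarith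
  have hf1 : ContDiff ℝ 1 f := hf.of_le (by exact_mod_cast le_top)
  have hfd := hf1.differentiable one_ne_zero
  have hK : IsCompact (tsupport f) := hsupp
  have hKc : IsClosed (tsupport f) := isClosed_tsupport f
  have hf0 : ∀ x, x ∉ tsupport f → f x = 0 := fun x hx => image_eq_zero_of_notMem_tsupport hx
  have hDf0 : ∀ x, x ∉ tsupport f → fderiv ℝ f x = 0 := fun x hx => fderiv_of_notMem_tsupport ℝ hx
  set h : EuclideanSpace ℝ (Fin n) → ℝ := fun x => ‖f x‖ ^ p with hh
  have hh1 : ContDiff ℝ 1 h := hf1.norm_rpow hp1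
  have hhd := hh1.differentiable one_ne_zero
  have hhv : ∀ x, x ∉ tsupport f → h x = 0 := fun x hx => by
    simp [hh, hf0 x hx, zero_rpow hp0.ne']
  have hg1 := aux_contDiff _ hKc h0 h hh1 hhv (-γ)
  have hgs := aux_supp _ hK h hhv (-γ)
  have hgI := hg1.continuous.integrable_of_hasCompactSupport hgs (μ := volume)
  set A : EuclideanSpace ℝ (Fin n) → ℝ := fun x => ‖fderiv ℝ f x‖ * ‖x‖ ^ (-α) with hA
  set B : EuclideanSpace ℝ (Fin n) → ℝ := fun x => ‖f x‖ ^ (p - 1) * ‖x‖ ^ (-β) with hB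
  have hAv : ∀ x, x ∉ tsupport f → ‖fderiv ℝ f x‖ = 0 := fun x hx => by simp [hDf0 x hx]
  have hBv : ∀ x, x ∉ tsupport f → ‖f x‖ ^ (p - 1) = 0 := fun x hx => by
    simp [hf0 x hx, zero_rpow hp2.ne']
  have hAc : Continuous A := aux_cont _ hKc h0 _ (hf1.continuous_fderiv one_ne_zero).norm hAv _
  have hBc : Continuous B := aux_cont _ hKc h0 _
    (hf1.continuous.norm.rpow_const (fun _ => Or.inr hp2.le)) hBv _
  have hAs : HasCompactSupport A := aux_supp _ hK _ hAv _
  have hBs : HasCompactSupport B := aux_supp _ hK _ hBv _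
  have hA0 : ∀ x, 0 ≤ A x := fun x => by positivity
  have hB0 : ∀ x, 0 ≤ B x := fun x => by positivity
  -- Hölder
  have hq : p.HolderConjugate (p / (p - 1)) := Real.HolderConjugate.conjExponent hp1
  have hold := integral_mul_le_Lp_mul_Lq_of_nonneg (μ := volume) hq
    (Filter.Eventually.of_forall hA0) (Filter.Eventually.of_forall hB0)
    (hAc.memLp_of_hasCompactSupport hAs) (hBc.memLp_of_hasCompactSupport hBs)
  have e1 : ∀ x, A x ^ p = ‖fderiv ℝ f x‖ ^ p / ‖x‖ ^ (α * p) := fun x => by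
    simp only [hA]
    rw [mul_rpow (by positivity) (by positivity), ← rpow_mul (by positivity), neg_mul,
      rpow_neg (by positivity), div_eq_mul_inv]
  have e2 : ∀ x, B x ^ (p / (p - 1)) = ‖f x‖ ^ p / ‖x‖ ^ (β * p / (p - 1)) := fun x => by
    simp only [hB]
    rw [mul_rpow (by positivity) (by positivity), ← rpow_mul (by positivity),
      ← rpow_mul (by positivity), neg_mul,
      rpow_neg (by positivity), ← div_eq_mul_inv, mul_div_cancel₀ _ hp2.ne', mul_div_assoc]
  simp_rw [e1, e2] at hold
  rw [one_div_div] at hold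
  refine le_trans ?_ hold
  -- integration by parts
  have hdiv := aux_div n _ hg1 hgs
  have heu := aux_euler h hhd (hhv 0 h0) (-γ)
  have hDI : Integrable (fun x => fderiv ℝ h x x * ‖x‖ ^ (-γ)) := by
    refine (aux_cont _ hKc h0 _ ((hh1.continuous_fderiv one_ne_zero).clm_apply continuous_id)
      ?_ _).integrable_of_hasCompactSupport (aux_supp _ hK _ ?_ _)
    all_goals
      intro x hx
      have := hfd.fderiv_norm_rpow (x := x) hp1
      simp only [hh, this, hDf0 x hx]
      simp
  simp_rw [heu] at hdiv
  rw [integral_add hDI (hgI.const_mul _), integral_const_mul] at hdiv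
  have e3 : ∀ x, ‖f x‖ ^ p / ‖x‖ ^ γ = h x * ‖x‖ ^ (-γ) := fun x => by
    rw [rpow_neg (by positivity), div_eq_mul_inv]
  simp_rw [e3]
  set I := ∫ x, h x * ‖x‖ ^ (-γ) with hI
  have hI0 : 0 ≤ I := integral_nonneg fun x => by positivity
  have hJ : ∫ x, fderiv ℝ h x x * ‖x‖ ^ (-γ) = -((n - γ) * I) := by linarith
  have hABI : Integrable (fun x => A x * B x) :=
    (hAc.mul hBc).integrable_of_hasCompactSupport hAs.mul_right
  have hb : ‖∫ x, fderiv ℝ h x x * ‖x‖ ^ (-γ)‖ ≤ ∫ x, p * (A x * B x) := by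
    refine norm_integral_le_of_norm_le (hABI.const_mul p) (Filter.Eventually.of_forall fun x => ?_)
    by_cases hx : x = 0
    · subst hx
      simp only [map_zero, zero_mul, norm_zero]
      have := hA0 0
      have := hB0 0
      positivity
    · have hxp : 0 < ‖x‖ := norm_pos_iff.2 hx
      have k1 := norm_fderiv_norm_rpow_le hfd (x := x) hp1
      have k2 := (fderiv ℝ h x).le_opNorm x
      have k3 : ‖x‖ * ‖x‖ ^ (-γ) = ‖x‖ ^ (-α) * ‖x‖ ^ (-β) := by
        rw [← rpow_add hxp, mul_comm, ← rpow_add_one hxp.ne']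
        congr 1; rw [hγ]; ring
      rw [norm_mul, norm_of_nonneg (by positivity : 0 ≤ ‖x‖ ^ (-γ))]
      calc _ ≤ (p * ‖f x‖ ^ (p - 1) * ‖fderiv ℝ f x‖ * ‖x‖) * ‖x‖ ^ (-γ) := by
            gcongr
            exact k2.trans (by gcongr)
        _ = p * ‖f x‖ ^ (p - 1) * ‖fderiv ℝ f x‖ * (‖x‖ * ‖x‖ ^ (-γ)) := by ring
        _ = _ := by rw [k3]; simp only [hA, hB]; ring
  rw [hJ, norm_neg, norm_mul, integral_const_mul, norm_of_nonneg hI0, Real.norm_eq_abs] at hb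
  rw [div_mul_eq_mul_div, div_le_iff₀ hp0]
  linarith
end

section
/- Let $n \ge 1$, $1 < p < \infty$, $\alpha, \beta \in \mathbb{R}$, and $\gamma = \alpha + \beta + 1$. Then for every smooth compactly supported $f : \mathbb{R}^n \to \mathbb{C}$ vanishing near the origin, $$\frac{|n-\gamma|}{p} \int_{\mathbb{R}^n} \frac{|f(x)|^p}{\|x\|^{\gamma}}\,dx \le \left(\int_{\mathbb{R}^n} \frac{\left|\frac{x}{\|x\|} \cdot \nabla f(x)\right|^p}{\|x\|^{\alpha p}}\,dx\right)^{1/p} \left(\int_{\mathbb{R}^n} \frac{|f(x)|^p}{\|x\|^{\beta p/(p-1)}}\,dx\right)^{(p-1)/p}.$$ -/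
open MeasureTheory Real Finset

noncomputable def Rop {n : ℕ} (f : EuclideanSpace ℝ (Fin n) → ℂ) :
    EuclideanSpace ℝ (Fin n) → ℂ :=
  fun x => ‖x‖⁻¹ • (fderiv ℝ f x x)

/-- Euler identity: the integral of `x · ∇g` is `-n` times the integral of `g`. -/
theorem euler_int (n : ℕ) (g : EuclideanSpace ℝ (Fin n) → ℝ)
    (hg : ContDiff ℝ 1 g) (hc : HasCompactSupport g) :
    ∫ x, fderiv ℝ g x x = -((n : ℝ) * ∫ x, g x) := by
  have hd : Differentiable ℝ g := hg.differentiable one_ne_zero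
  have hcd : ∀ v, Continuous (fun x => fderiv ℝ g x v) := fun v =>
    (hg.continuous_fderiv one_ne_zero).clm_apply continuous_const
  have hcs : ∀ v, HasCompactSupport (fun x => fderiv ℝ g x v) := fun v =>
    hc.fderiv_apply (𝕜 := ℝ) v
  let e : Fin n → EuclideanSpace ℝ (Fin n) := fun i => EuclideanSpace.single i (1 : ℝ)
  let L : Fin n → (EuclideanSpace ℝ (Fin n) →L[ℝ] ℝ) := fun i => EuclideanSpace.proj i
  have hi : ∀ i, Integrable (fun x => L i x * fderiv ℝ g x (e i)) := fun i =>
    ((L i).continuous.mul (hcd _)).integrable_of_hasCompactSupport ((hcs _).mul_left)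
  have hgi : Integrable g := hg.continuous.integrable_of_hasCompactSupport hc
  have key : ∀ i, ∫ x, L i x * fderiv ℝ g x (e i) = - ∫ x, g x := by
    intro i
    have hL : ∀ x, fderiv ℝ (fun y => L i y) x (e i) = 1 := by
      intro x
      have : fderiv ℝ (fun y => L i y) x = L i := (L i).fderiv
      rw [this]
      simp [L, e]
    have := integral_mul_fderiv_eq_neg_fderiv_mul_of_integrable (μ := volume)
      (f := fun x => L i x) (g := g) (v := e i)
      (by simp only [hL, one_mul]; exact hgi) (hi i)
      (((L i).continuous.mul hg.continuous).integrable_of_hasCompactSupport hc.mul_left)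
      (fun x _ => (L i).differentiableAt) (fun x _ => hd x)
    rw [this]
    simp only [hL, one_mul]
  have hx : ∀ x, fderiv ℝ g x x = ∑ i, L i x * fderiv ℝ g x (e i) := by
    intro x
    have h1 : x = ∑ i, (L i x) • e i := by
      ext j
      simp [L, e, Pi.single_apply]
    conv_lhs => rw [h1, map_sum]
    simp only [map_smul, smul_eq_mul]
    rw [← h1]
  simp_rw [hx]
  rw [integral_finsetSum _ (fun i _ => hi i)]
  simp [key]

theorem cont_aux {n : ℕ} {F : Type*} [NormedAddCommGroup F] [NormedSpace ℝ F]
    {K : Set (EuclideanSpace ℝ (Fin n))} (hK : IsClosed K) (h0 : (0 : EuclideanSpace ℝ (Fin n)) ∉ K)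
    {h : EuclideanSpace ℝ (Fin n) → F} (hz : ∀ x ∉ K, h x = 0)
    (hc : ∀ x ≠ 0, ContinuousAt h x) : Continuous h := by
  rw [continuous_iff_continuousAt]
  intro x
  by_cases hx : x = 0
  · subst hx
    have : h =ᶠ[nhds 0] fun _ => 0 := by
      filter_upwards [hK.isOpen_compl.mem_nhds h0] with y hy using hz y hy
    exact continuousAt_const.congr this.symm
  · exact hc x hx

theorem stmt1 (n : ℕ) (hn : 1 ≤ n) (p α β γ : ℝ) (hp1 : 1 < p)
    (hγ : γ = α + β + 1)
    (f : EuclideanSpace ℝ (Fin n) → ℂ)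
    (hf : ContDiff ℝ (⊤ : ℕ∞) f) (hsupp : HasCompactSupport f)
    (h0 : (0 : EuclideanSpace ℝ (Fin n)) ∉ tsupport f) :
    |(n : ℝ) - γ| / p * ∫ x, ‖f x‖ ^ p / ‖x‖ ^ γ ≤
      (∫ x, ‖Rop f x‖ ^ p / ‖x‖ ^ (α * p)) ^ (1 / p) *
        (∫ x, ‖f x‖ ^ p / ‖x‖ ^ (β * p / (p - 1))) ^ ((p - 1) / p) := by
  have hp0 : 0 < p := by linarith
  have hq0 : 0 < p - 1 := by linarith
  have hK : IsClosed (tsupport f) := isClosed_tsupport f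
  have hf0 : ∀ x ∉ tsupport f, f x = 0 := fun x hx => image_eq_zero_of_notMem_tsupport hx
  have hdf0 : ∀ x ∉ tsupport f, fderiv ℝ f x = 0 := fun x hx =>
    image_eq_zero_of_notMem_tsupport (fun h => hx (tsupport_fderiv_subset ℝ h))
  have hf1 : ContDiff ℝ 1 f := hf.of_le (by exact_mod_cast le_top)
  have hdiff : Differentiable ℝ f := hf1.differentiable one_ne_zero
  have hcdf : Continuous (fderiv ℝ f) := hf1.continuous_fderiv one_ne_zero
  let A : EuclideanSpace ℝ (Fin n) → ℝ := fun x => ‖Rop f x‖ / ‖x‖ ^ α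
  let B : EuclideanSpace ℝ (Fin n) → ℝ := fun x => ‖f x‖ ^ (p - 1) / ‖x‖ ^ β
  let g : EuclideanSpace ℝ (Fin n) → ℝ := fun x => ‖f x‖ ^ p / ‖x‖ ^ γ
  have hA0 : ∀ x ∉ tsupport f, A x = 0 := fun x hx => by simp [A, Rop, hdf0 x hx]
  have hB0 : ∀ x ∉ tsupport f, B x = 0 := fun x hx => by
    simp [A, B, hf0 x hx, Real.zero_rpow hq0.ne']
  have hg0 : ∀ x ∉ tsupport f, g x = 0 := fun x hx => by
    simp [g, hf0 x hx, Real.zero_rpow hp0.ne']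
  have hw : ∀ (s : ℝ) (x : EuclideanSpace ℝ (Fin n)), x ≠ 0 →
      ContinuousAt (fun x : EuclideanSpace ℝ (Fin n) => ‖x‖ ^ s) x := fun s x hx =>
    continuous_norm.continuousAt.rpow_const (Or.inl (norm_ne_zero_iff.2 hx))
  have hwn : ∀ (s : ℝ) (x : EuclideanSpace ℝ (Fin n)), x ≠ 0 → ‖x‖ ^ s ≠ 0 := fun s x hx =>
    (Real.rpow_pos_of_pos (norm_pos_iff.2 hx) s).ne'
  have hAc : Continuous A := cont_aux hK h0 hA0 fun x hx => by
    refine ContinuousAt.div (ContinuousAt.norm ?_) (hw α x hx) (hwn α x hx)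
    exact (continuous_norm.continuousAt.inv₀ (norm_ne_zero_iff.2 hx)).smul
      (hcdf.clm_apply continuous_id).continuousAt
  have hBc : Continuous B := cont_aux hK h0 hB0 fun x hx =>
    ContinuousAt.div (hf.continuous.norm.continuousAt.rpow_const (Or.inr hq0.le))
      (hw β x hx) (hwn β x hx)
  have hAs : HasCompactSupport A := HasCompactSupport.intro hsupp hA0
  have hBs : HasCompactSupport B := HasCompactSupport.intro hsupp hB0
  have hgs : HasCompactSupport g := HasCompactSupport.intro hsupp hg0
  have hgc : ContDiff ℝ 1 g := by
    rw [contDiff_iff_contDiffAt]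
    intro x
    by_cases hx : x = 0
    · subst hx
      have : g =ᶠ[nhds 0] fun _ => 0 := by
        filter_upwards [hK.isOpen_compl.mem_nhds h0] with y hy using hg0 y hy
      exact contDiffAt_const.congr_of_eventuallyEq this
    · exact (hf1.norm_rpow hp1).contDiffAt.div
        ((contDiffAt_norm ℝ hx).rpow_const_of_ne (norm_ne_zero_iff.2 hx)) (hwn γ x hx)
  have hgi : Integrable g := hgc.continuous.integrable_of_hasCompactSupport hgs
  have hdgi : Integrable (fun x => fderiv ℝ g x x) :=
    ((hgc.continuous_fderiv one_ne_zero).clm_apply continuous_id).integrable_of_hasCompactSupport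
      (HasCompactSupport.intro hgs fun x hx => by
        have : fderiv ℝ g x = 0 :=
          image_eq_zero_of_notMem_tsupport (fun h => hx (tsupport_fderiv_subset ℝ h))
        simp [this])
  have hpt : ∀ x, |fderiv ℝ g x x + γ * g x| ≤ p * (A x * B x) := by
    intro x
    by_cases hx : x = 0
    · subst hx
      simp [hg0 0 h0, hA0 0 h0]
    have hxp : 0 < ‖x‖ := norm_pos_iff.2 hx
    have h1 := (hasFDerivAt_norm_rpow (f x) hp1).comp x (hdiff x).hasFDerivAt
    have hN : HasFDerivAt (fun y : EuclideanSpace ℝ (Fin n) => ‖y‖ ^ (-γ))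
        ((-γ * ‖x‖ ^ (-γ - 2)) • innerSL ℝ x) x := by
      have h2 := (hasStrictFDerivAt_norm_sq x).hasFDerivAt.rpow_const (p := -γ / 2)
        (Or.inl (by positivity))
      have e1 : (fun y : EuclideanSpace ℝ (Fin n) => ‖y‖ ^ (-γ))
          = fun y => (‖y‖ ^ 2) ^ (-γ / 2) := by
        ext y
        rw [← Real.rpow_natCast, ← Real.rpow_mul (norm_nonneg _)]
        congr 1; push_cast; ring
      rw [e1]
      refine h2.congr_fderiv ?_
      rw [← Real.rpow_natCast ‖x‖, ← Real.rpow_mul (norm_nonneg _)]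
      ext v
      simp only [smul_apply, smul_eq_mul, nsmul_eq_mul, Nat.cast_ofNat]
      rw [show (2 : ℝ) * (-γ / 2 - 1) = -γ - 2 by ring]
      ring
    have h3 := h1.mul hN
    have e2 : g = (((fun x : ℂ => ‖x‖ ^ p) ∘ f) * fun y => ‖y‖ ^ (-γ)) := by
      ext y
      simp [g, Real.rpow_neg (norm_nonneg y), div_eq_mul_inv]
    have h4 : fderiv ℝ g x x = ‖f x‖ ^ p * (-γ * ‖x‖ ^ (-γ - 2) * ‖x‖ ^ 2)
        + ‖x‖ ^ (-γ) * (p * ‖f x‖ ^ (p - 2) * inner ℝ (f x) (fderiv ℝ f x x)) := by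
      rw [e2, HasFDerivAt.fderiv h3]
      simp [real_inner_self_eq_norm_sq]
    have h5 : ‖x‖ ^ (-γ - 2) * ‖x‖ ^ 2 = ‖x‖ ^ (-γ) := by
      rw [← Real.rpow_natCast, ← Real.rpow_add hxp]; congr 1; push_cast; ring
    have h6 : g x = ‖f x‖ ^ p * ‖x‖ ^ (-γ) := by
      simp [g, Real.rpow_neg (norm_nonneg x), div_eq_mul_inv]
    have h7 : fderiv ℝ g x x + γ * g x
        = ‖x‖ ^ (-γ) * (p * ‖f x‖ ^ (p - 2) * inner ℝ (f x) (fderiv ℝ f x x)) := by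
      rw [h4, h6, mul_assoc (-γ), h5]; ring
    have h8 : A x * B x = ‖x‖ ^ (-γ) * (‖f x‖ ^ (p - 1) * ‖fderiv ℝ f x x‖) := by
      simp only [A, B, Rop, norm_smul, norm_inv, norm_norm]
      rw [hγ, neg_add, neg_add, Real.rpow_add hxp, Real.rpow_add hxp, Real.rpow_neg hxp.le,
        Real.rpow_neg hxp.le, Real.rpow_neg_one]
      field_simp
    rw [h7, h8, abs_mul, abs_mul, abs_mul, abs_of_pos hp0,
      abs_of_nonneg (by positivity : 0 ≤ ‖x‖ ^ (-γ)),
      abs_of_nonneg (by positivity : 0 ≤ ‖f x‖ ^ (p - 2))]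
    have h9 : ‖f x‖ ^ (p - 2) * ‖f x‖ = ‖f x‖ ^ (p - 1) := by
      rw [← Real.rpow_add_one' (norm_nonneg _) (by linarith)]; congr 1; ring
    calc _ ≤ ‖x‖ ^ (-γ) * (p * ‖f x‖ ^ (p - 2) * (‖f x‖ * ‖fderiv ℝ f x x‖)) := by
          gcongr
          exact abs_real_inner_le_norm _ _
      _ = _ := by rw [← h9]; ring
  have hABi : Integrable (fun x => A x * B x) :=
    (hAc.mul hBc).integrable_of_hasCompactSupport hAs.mul_right
  have hI : |(n : ℝ) - γ| * ∫ x, g x ≤ p * ∫ x, A x * B x := by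
    have hE := euler_int n g hgc hgs
    have hgnn : 0 ≤ ∫ x, g x := integral_nonneg fun x => by simp only [g]; positivity
    have h1 : ∫ x, (fderiv ℝ g x x + γ * g x) = -(((n : ℝ) - γ) * ∫ x, g x) := by
      rw [integral_add hdgi (hgi.const_mul γ), hE, integral_const_mul]; ring
    calc |(n : ℝ) - γ| * ∫ x, g x = |∫ x, (fderiv ℝ g x x + γ * g x)| := by
          rw [h1, abs_neg, abs_mul, abs_of_nonneg hgnn]
      _ ≤ ∫ x, |fderiv ℝ g x x + γ * g x| := abs_integral_le_integral_abs
      _ ≤ ∫ x, p * (A x * B x) :=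
          integral_mono (hdgi.add (hgi.const_mul γ)).abs (hABi.const_mul p) hpt
      _ = _ := integral_const_mul _ _
  have hpq : p.HolderConjugate (p / (p - 1)) := Real.HolderConjugate.conjExponent hp1
  have hH := integral_mul_le_Lp_mul_Lq_of_nonneg (μ := volume) hpq (f := A) (g := B)
    (Filter.Eventually.of_forall fun x => by simp only [A, Pi.zero_apply]; positivity)
    (Filter.Eventually.of_forall fun x => by simp only [B, Pi.zero_apply]; positivity)
    (hAc.memLp_of_hasCompactSupport hAs) (hBc.memLp_of_hasCompactSupport hBs)
  have eA : ∀ x, A x ^ p = ‖Rop f x‖ ^ p / ‖x‖ ^ (α * p) := fun x => by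
    simp only [A]
    rw [Real.div_rpow (norm_nonneg _) (by positivity), ← Real.rpow_mul (norm_nonneg _)]
  have eB : ∀ x, B x ^ (p / (p - 1)) = ‖f x‖ ^ p / ‖x‖ ^ (β * p / (p - 1)) := fun x => by
    simp only [B]
    rw [Real.div_rpow (by positivity) (by positivity), ← Real.rpow_mul (norm_nonneg _),
      ← Real.rpow_mul (norm_nonneg _), mul_div_cancel₀ _ hq0.ne', mul_div_assoc]
  simp only [eA, eB, one_div_div] at hH
  calc |(n : ℝ) - γ| / p * ∫ x, ‖f x‖ ^ p / ‖x‖ ^ γ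
      = (|(n : ℝ) - γ| * ∫ x, g x) / p := by simp only [g]; ring
    _ ≤ ∫ x, A x * B x := by rw [div_le_iff₀ hp0, mul_comm]; linarith
    _ ≤ _ := hH
end

section
/- Let $n \ge 2$, $1 < p < n$. For all $f \in C_0^\infty(\mathbb{R}^n \setminus \{0\})$, $$\left(\int_{\mathbb{R}^n} |f(x)|^2 dx\right)^2 \le \left(\frac{p}{n-p}\right)^2 \left(\int_{\mathbb{R}^n} |\nabla f(x)|^p dx\right)^{2/p} \left(\int_{\mathbb{R}^n} \|x\|^{p/(p-1)} |f(x)|^{p/(p-1)} dx\right)^{2(p-1)/p}.$$ -/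
open MeasureTheory Real

theorem euler_ibp (n : ℕ) (h : EuclideanSpace ℝ (Fin n) → ℝ) (hh : ContDiff ℝ 1 h)
    (hc : HasCompactSupport h) :
    ∫ x, fderiv ℝ h x x = - (n * ∫ x, h x) := by
  have hcf : Continuous (fderiv ℝ h) := hh.continuous_fderiv one_ne_zero
  have hcs : HasCompactSupport (fderiv ℝ h) := hc.fderiv ℝ
  have hint : ∀ i : Fin n, Integrable (fun x : EuclideanSpace ℝ (Fin n) =>
      EuclideanSpace.proj (𝕜 := ℝ) i x * fderiv ℝ h x (EuclideanSpace.single i 1)) := by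
    intro i
    apply Continuous.integrable_of_hasCompactSupport
    · exact (EuclideanSpace.proj (𝕜 := ℝ) i).continuous.mul (hcf.clm_apply continuous_const)
    · exact (hcs.comp_left (g := fun L : EuclideanSpace ℝ (Fin n) →L[ℝ] ℝ =>
        L (EuclideanSpace.single i 1)) (by simp)).mul_left
  have key : ∀ i : Fin n, ∫ x : EuclideanSpace ℝ (Fin n),
      EuclideanSpace.proj (𝕜 := ℝ) i x * fderiv ℝ h x (EuclideanSpace.single i 1) = - ∫ x, h x := by
    intro i
    have hfd : ∀ x, fderiv ℝ (fun x : EuclideanSpace ℝ (Fin n) => EuclideanSpace.proj (𝕜 := ℝ) i x) x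
        (EuclideanSpace.single i 1) = 1 := by
      intro x
      have := (EuclideanSpace.proj i : EuclideanSpace ℝ (Fin n) →L[ℝ] ℝ).hasFDerivAt (x := x)
      rw [this.fderiv]
      simp
    rw [integral_mul_fderiv_eq_neg_fderiv_mul_of_integrable]
    · simp_rw [hfd, one_mul]
    · simp_rw [hfd, one_mul]
      exact hh.continuous.integrable_of_hasCompactSupport hc
    · exact hint i
    · apply Continuous.integrable_of_hasCompactSupport
      · exact (EuclideanSpace.proj (𝕜 := ℝ) i).continuous.mul hh.continuous
      · exact hc.mul_left
    · intro x _
      exact (EuclideanSpace.proj (𝕜 := ℝ) i).differentiableAt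
    · intro x _
      exact hh.differentiable one_ne_zero x
  have e : ∀ x : EuclideanSpace ℝ (Fin n), fderiv ℝ h x x = ∑ i : Fin n,
      EuclideanSpace.proj (𝕜 := ℝ) i x * fderiv ℝ h x (EuclideanSpace.single i 1) := by
    intro x
    have hx : x = ∑ i : Fin n, x i • EuclideanSpace.single i (1 : ℝ) := by
      ext j
      simp [Finset.sum_apply, Pi.single_apply]
    conv_lhs => rw [hx, ← hx]
    conv_lhs => 
      arg 2
      rw [hx]
    simp [map_sum]
  simp_rw [e]
  rw [integral_finsetSum _ (fun i _ => hint i)]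
  simp_rw [key]
  simp

theorem u_contDiff {n : ℕ} {f : EuclideanSpace ℝ (Fin n) → ℂ}
    (hf : ContDiff ℝ (⊤ : ℕ∞) f) (h0 : (0 : EuclideanSpace ℝ (Fin n)) ∉ tsupport f) :
    ContDiff ℝ 1 (fun x => ‖x‖⁻¹ • f x) := by
  rw [contDiff_iff_contDiffAt]
  intro x
  by_cases hx : x ∈ tsupport f
  · have hx0 : x ≠ 0 := fun h => h0 (h ▸ hx)
    have h1 : ContDiffAt ℝ 1 (fun x : EuclideanSpace ℝ (Fin n) => ‖x‖⁻¹) x :=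
      (contDiffAt_norm ℝ hx0).inv (norm_ne_zero_iff.2 hx0)
    exact h1.smul (hf.contDiffAt.of_le (by exact_mod_cast le_top))
  · have : f =ᶠ[nhds x] 0 := notMem_tsupport_iff_eventuallyEq.1 hx
    have h2 : (fun x => ‖x‖⁻¹ • f x) =ᶠ[nhds x] fun _ => 0 := by
      filter_upwards [this] with y hy
      simp [hy]
    exact contDiffAt_const.congr_of_eventuallyEq h2

theorem u_deriv {n : ℕ} {f : EuclideanSpace ℝ (Fin n) → ℂ}
    (hf : ContDiff ℝ (⊤ : ℕ∞) f) (x : EuclideanSpace ℝ (Fin n)) (hx : x ≠ 0) :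
    fderiv ℝ (fun x => ‖x‖⁻¹ • f x) x x = ‖x‖⁻¹ • fderiv ℝ f x x - ‖x‖⁻¹ • f x := by
  have hn : ‖x‖ ≠ 0 := norm_ne_zero_iff.2 hx
  have d1 : DifferentiableAt ℝ (fun x : EuclideanSpace ℝ (Fin n) => ‖x‖) x :=
    (contDiffAt_norm ℝ hx).differentiableAt (n := 1) one_ne_zero
  have hd := d1.hasFDerivAt
  have h2 := (hasDerivAt_inv hn).comp_hasFDerivAt x hd
  have h3 := h2.smul (hf.differentiable (by simp) x).hasFDerivAt
  have h4 : fderiv ℝ (fun x => ‖x‖⁻¹ • f x) x = _ := h3.fderiv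
  rw [h4]
  have h5 : fderiv ℝ (fun x : EuclideanSpace ℝ (Fin n) => ‖x‖) x x = ‖x‖ := DifferentiableAt.fderiv_norm_self d1
  simp [h5]
  field_simp
  ring

theorem pointwise_bd {n : ℕ} {f : EuclideanSpace ℝ (Fin n) → ℂ} {p : ℝ} (hp1 : 1 < p)
    (hf : ContDiff ℝ (⊤ : ℕ∞) f) (h0 : (0 : EuclideanSpace ℝ (Fin n)) ∉ tsupport f)
    (x : EuclideanSpace ℝ (Fin n)) :
    - fderiv ℝ (fun x => ‖‖x‖⁻¹ • f x‖ ^ p) x x ≤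
      p * (‖fderiv ℝ f x‖ * ‖‖x‖⁻¹ • f x‖ ^ (p - 1)) + p * ‖‖x‖⁻¹ • f x‖ ^ p := by
  by_cases hx : x = 0
  · subst hx
    have : p ≠ 0 := by linarith
    have h2 : p - 1 ≠ 0 := by linarith
    simp [Real.zero_rpow this, Real.zero_rpow h2]
  rw [((u_contDiff hf h0).differentiable one_ne_zero).fderiv_norm_rpow hp1]
  simp only [smul_apply, ContinuousLinearMap.comp_apply, innerSL_apply_apply,
    smul_eq_mul]
  rw [u_deriv hf x hx]
  set u := ‖x‖⁻¹ • f x with hu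
  set w := ‖x‖⁻¹ • fderiv ℝ f x x with hw
  have hn : 0 < ‖x‖ := norm_pos_iff.2 hx
  have hwn : ‖w‖ ≤ ‖fderiv ℝ f x‖ := by
    rw [hw, norm_smul, norm_inv, norm_norm, inv_mul_le_iff₀ hn, mul_comm]
    exact (fderiv ℝ f x).le_opNorm x
  by_cases h : u = 0
  · rw [h]
    simp only [inner_zero_left, mul_zero, neg_zero]
    have := norm_nonneg (fderiv ℝ f x)
    positivity
  have hup : 0 < ‖u‖ := norm_pos_iff.2 h
  rw [inner_sub_right, real_inner_self_eq_norm_sq]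
  have e1 : ‖u‖ ^ p = ‖u‖ ^ (p - 2) * ‖u‖ ^ 2 := by
    rw [← Real.rpow_natCast, ← Real.rpow_add hup]; norm_num
  have e2 : ‖u‖ ^ (p - 1) = ‖u‖ ^ (p - 2) * ‖u‖ := by
    conv_rhs => rw [← Real.rpow_one ‖u‖, ← Real.rpow_mul hup.le, ← Real.rpow_add hup]
    congr 1; ring
  have hi : - inner ℝ u w ≤ ‖u‖ * ‖fderiv ℝ f x‖ :=
    (neg_le_abs _).trans ((abs_real_inner_le_norm u w).trans (by gcongr))
  rw [e1, e2]
  have hc : 0 ≤ p * ‖u‖ ^ (p - 2) := by positivity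
  have := mul_le_mul_of_nonneg_left hi hc
  linarith

theorem stmt6 (n : ℕ) (hn : 2 ≤ n) (p : ℝ) (hp1 : 1 < p) (hpn : p < n)
    (f : EuclideanSpace ℝ (Fin n) → ℂ)
    (hf : ContDiff ℝ (⊤ : ℕ∞) f) (hsupp : HasCompactSupport f)
    (h0 : (0 : EuclideanSpace ℝ (Fin n)) ∉ tsupport f) :
    (∫ x, ‖f x‖ ^ 2) ^ 2 ≤
      (p / ((n : ℝ) - p)) ^ 2 * (∫ x, ‖fderiv ℝ f x‖ ^ p) ^ (2 / p) *
        (∫ x, ‖x‖ ^ (p / (p - 1)) * ‖f x‖ ^ (p / (p - 1))) ^ (2 * (p - 1) / p) := by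
  have hp0 : 0 < p := by linarith
  have hp10 : 0 < p - 1 := by linarith
  have hnp : 0 < (n : ℝ) - p := by linarith
  have hpq : p.HolderConjugate (p / (p - 1)) := Real.HolderConjugate.conjExponent hp1
  set q := p / (p - 1) with hq
  have hq0 : 0 < q := by positivity
  obtain ⟨u, hu⟩ : ∃ u : EuclideanSpace ℝ (Fin n) → ℂ, u = fun x => ‖x‖⁻¹ • f x := ⟨_, rfl⟩
  have huC : ContDiff ℝ 1 u := hu ▸ u_contDiff hf h0
  have hus : HasCompactSupport u := by
    rw [hu]
    refine hsupp.mono ?_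
    intro x hx hx2
    exact hx (by simp [hx2])
  have hfc : Continuous (fderiv ℝ f) := hf.continuous_fderiv (by simp)
  have hfs : HasCompactSupport (fderiv ℝ f) := hsupp.fderiv ℝ
  have hhC : ContDiff ℝ 1 (fun x => ‖u x‖ ^ p) := huC.norm_rpow hp1
  have hhs : HasCompactSupport (fun x => ‖u x‖ ^ p) :=
    hus.comp_left (g := fun z : ℂ => ‖z‖ ^ p) (by simp [Real.zero_rpow hp0.ne'])
  have hus1 : HasCompactSupport (fun x => ‖u x‖ ^ (p - 1)) :=
    hus.comp_left (g := fun z : ℂ => ‖z‖ ^ (p - 1)) (by simp [Real.zero_rpow hp10.ne'])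
  have huc1 : Continuous (fun x => ‖u x‖ ^ (p - 1)) :=
    huC.continuous.norm.rpow_const (fun _ => Or.inr hp10.le)
  have hhI : Integrable (fun x => ‖u x‖ ^ p) := hhC.continuous.integrable_of_hasCompactSupport hhs
  have hDI : Integrable (fun x => ‖fderiv ℝ f x‖ * ‖u x‖ ^ (p - 1)) :=
    (hfc.norm.mul huc1).integrable_of_hasCompactSupport hus1.mul_left
  have hEI : Integrable (fun x => fderiv ℝ (fun x => ‖u x‖ ^ p) x x) := by
    apply Continuous.integrable_of_hasCompactSupport
    · exact (hhC.continuous_fderiv one_ne_zero).clm_apply continuous_id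
    · refine (hhs.fderiv ℝ).mono ?_
      intro x hx hx2
      exact hx (by simp [hx2])
  set A := ∫ x, ‖u x‖ ^ p with hA
  set B := ∫ x, ‖fderiv ℝ f x‖ ^ p with hB
  set C := ∫ x, ‖x‖ ^ q * ‖f x‖ ^ q with hC
  have hA0 : 0 ≤ A := integral_nonneg fun x => by positivity
  have hB0 : 0 ≤ B := integral_nonneg fun x => by positivity
  have hC0 : 0 ≤ C := integral_nonneg fun x => by positivity
  have s1 : n * A ≤ p * (∫ x, ‖fderiv ℝ f x‖ * ‖u x‖ ^ (p - 1)) + p * A := by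
    have := euler_ibp n _ hhC hhs
    rw [eq_neg_iff_add_eq_zero, add_eq_zero_iff_neg_eq] at this
    rw [hA, ← this, ← integral_neg, ← integral_const_mul, ← integral_const_mul,
      ← integral_add (hDI.const_mul _) (hhI.const_mul _)]
    refine integral_mono hEI.neg ((hDI.const_mul _).add (hhI.const_mul _)) ?_
    intro x
    have := pointwise_bd hp1 hf h0 x
    rw [hu]
    exact this
  have s2 : ∫ x, ‖fderiv ℝ f x‖ * ‖u x‖ ^ (p - 1) ≤ B ^ (1 / p) * A ^ (1 / q) := by
    have := integral_mul_le_Lp_mul_Lq_of_nonneg (μ := (volume : Measure (EuclideanSpace ℝ (Fin n))))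
      hpq (f := fun x => ‖fderiv ℝ f x‖) (g := fun x => ‖u x‖ ^ (p - 1))
      (Filter.Eventually.of_forall fun x => by positivity)
      (Filter.Eventually.of_forall fun x => by positivity)
      (hfc.norm.memLp_of_hasCompactSupport hfs.norm) (huc1.memLp_of_hasCompactSupport hus1)
    have e : ∀ x, (‖u x‖ ^ (p - 1)) ^ q = ‖u x‖ ^ p := by
      intro x
      rw [← Real.rpow_mul (norm_nonneg _)]
      congr 1
      rw [hq]; field_simp
    simp_rw [e] at this
    exact this
  have s3 : A ^ (1 / p) ≤ p / (n - p) * B ^ (1 / p) := by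
    rcases hA0.eq_or_lt with h | h
    · rw [← h, Real.zero_rpow (by positivity)]
      positivity
    · have hAq : 0 < A ^ (1 / q) := by positivity
      have hAA : A = A ^ (1 / p) * A ^ (1 / q) := by
        rw [← Real.rpow_add h]
        have := hpq.inv_add_inv_eq_one
        rw [one_div, one_div, this, Real.rpow_one]
      have h1 : (n - p) * (A ^ (1 / p) * A ^ (1 / q)) ≤ p * (B ^ (1 / p) * A ^ (1 / q)) := by
        rw [← hAA]
        have := mul_le_mul_of_nonneg_left s2 hp0.le
        linarith
      have h2 : (n - p) * A ^ (1 / p) ≤ p * B ^ (1 / p) := by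
        refine le_of_mul_le_mul_right ?_ hAq
        linarith
      rw [div_mul_eq_mul_div, le_div_iff₀ hnp]
      linarith
  have s4 : ∫ x, ‖f x‖ ^ 2 ≤ A ^ (1 / p) * C ^ (1 / q) := by
    have hcx : Continuous fun x : EuclideanSpace ℝ (Fin n) => ‖x‖ * ‖f x‖ :=
      continuous_norm.mul hf.continuous.norm
    have := integral_mul_le_Lp_mul_Lq_of_nonneg (μ := (volume : Measure (EuclideanSpace ℝ (Fin n))))
      hpq (f := fun x => ‖u x‖) (g := fun x => ‖x‖ * ‖f x‖)
      (Filter.Eventually.of_forall fun x => by positivity)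
      (Filter.Eventually.of_forall fun x => by positivity)
      (huC.continuous.norm.memLp_of_hasCompactSupport hus.norm)
      (hcx.memLp_of_hasCompactSupport hsupp.norm.mul_left)
    have e : ∀ x, ‖u x‖ * (‖x‖ * ‖f x‖) = ‖f x‖ ^ 2 := by
      intro x
      by_cases hx : x = 0
      · have : f x = 0 := image_eq_zero_of_notMem_tsupport (hx ▸ h0)
        simp [this]
      · have : ‖x‖ ≠ 0 := norm_ne_zero_iff.2 hx
        rw [hu]
        simp only [norm_smul, norm_inv, norm_norm]
        field_simp
    simp_rw [e, Real.mul_rpow (norm_nonneg _) (norm_nonneg _)] at this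
    exact this
  have hI0 : 0 ≤ ∫ x, ‖f x‖ ^ 2 := integral_nonneg fun x => by positivity
  have s5 : ∫ x, ‖f x‖ ^ 2 ≤ p / (n - p) * B ^ (1 / p) * C ^ (1 / q) :=
    s4.trans (by gcongr)
  have eB : B ^ (2 / p) = (B ^ (1 / p)) ^ 2 := by
    rw [← Real.rpow_natCast, ← Real.rpow_mul hB0]; congr 1; push_cast; ring
  have eC : C ^ (2 * (p - 1) / p) = (C ^ (1 / q)) ^ 2 := by
    rw [← Real.rpow_natCast, ← Real.rpow_mul hC0]; congr 1; push_cast; rw [hq]; field_simp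
  rw [eB, eC, ← mul_pow, ← mul_pow]
  gcongr
end

section
/- Let $n \ge 1$, $1 < p < \infty$, and $\alpha \in \mathbb{R}$ with $\alpha \ne \frac{n}{p} - 1$. Then for all $f \in C_0^\infty(\mathbb{R}^n \setminus \{0\})$, $$\left(\int_{\mathbb{R}^n} \frac{|f(x)|^p}{\|x\|^{(\alpha+1)p}} dx\right)^{1/p} \le \frac{p}{|n - p(\alpha+1)|} \left(\int_{\mathbb{R}^n} \frac{|\nabla f(x)|^p}{\|x\|^{\alpha p}} dx\right)^{1/p}.$$ -/
open MeasureTheory Real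

lemma aux_contDiff_s7 {n : ℕ} {k : WithTop ℕ∞} (r : ℝ) (φ : EuclideanSpace ℝ (Fin n) → ℝ)
    (hφ : ContDiff ℝ k φ) (h0 : (0 : EuclideanSpace ℝ (Fin n)) ∉ tsupport φ) :
    ContDiff ℝ k (fun x => φ x * ‖x‖ ^ r) := by
  rw [contDiff_iff_contDiffAt]
  intro x
  by_cases hx : x = 0
  · subst hx
    rw [notMem_tsupport_iff_eventuallyEq] at h0
    refine (contDiffAt_const (c := (0 : ℝ))).congr_of_eventuallyEq ?_
    filter_upwards [h0] with y hy
    simp [hy]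
  · exact hφ.contDiffAt.mul ((contDiffAt_norm ℝ hx).rpow_const_of_ne (norm_ne_zero_iff.mpr hx))

lemma aux_continuous {n : ℕ} (r : ℝ) (φ : EuclideanSpace ℝ (Fin n) → ℝ)
    (hφ : Continuous φ) (h0 : (0 : EuclideanSpace ℝ (Fin n)) ∉ tsupport φ) :
    Continuous (fun x => φ x * ‖x‖ ^ r) :=
  contDiff_zero.mp (aux_contDiff_s7 (k := 0) r φ (contDiff_zero.mpr hφ) h0)

lemma aux_euler_s7 {n : ℕ} (h : EuclideanSpace ℝ (Fin n) → ℝ)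
    (hh : ContDiff ℝ 1 h) (hs : HasCompactSupport h) :
    ∫ x, fderiv ℝ h x x = - (n : ℝ) * ∫ x, h x := by
  have hcd : Continuous (fderiv ℝ h) := hh.continuous_fderiv one_ne_zero
  have hfd : ∀ (i : Fin n) (x : EuclideanSpace ℝ (Fin n)),
      fderiv ℝ (fun y : EuclideanSpace ℝ (Fin n) => y i) x (EuclideanSpace.single i 1) = 1 := by
    intro i x
    have : HasFDerivAt (fun y : EuclideanSpace ℝ (Fin n) => y i)
        (EuclideanSpace.proj i : EuclideanSpace ℝ (Fin n) →L[ℝ] ℝ) x :=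
      (EuclideanSpace.proj i : EuclideanSpace ℝ (Fin n) →L[ℝ] ℝ).hasFDerivAt
    rw [this.fderiv]
    simp
  have hint : ∀ i : Fin n, Integrable (fun x : EuclideanSpace ℝ (Fin n) =>
      x i * fderiv ℝ h x (EuclideanSpace.single i 1)) := by
    intro i
    apply Continuous.integrable_of_hasCompactSupport
    · fun_prop
    · exact (hs.fderiv_apply ℝ _).mul_left
  have key : ∀ i : Fin n, ∫ x : EuclideanSpace ℝ (Fin n),
      x i * fderiv ℝ h x (EuclideanSpace.single i 1) = - ∫ x, h x := by
    intro i
    have hi : Integrable h := hh.continuous.integrable_of_hasCompactSupport hs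
    rw [integral_mul_fderiv_eq_neg_fderiv_mul_of_integrable]
    · simp_rw [hfd, one_mul]
    · simp_rw [hfd, one_mul]; exact hi
    · exact hint i
    · apply Continuous.integrable_of_hasCompactSupport
      · have := hh.continuous
        fun_prop
      · exact hs.mul_left
    · intro x _
      fun_prop
    · intro x _
      exact hh.differentiable one_ne_zero x
  have hsum : ∀ x : EuclideanSpace ℝ (Fin n), fderiv ℝ h x x =
      ∑ i, x i * fderiv ℝ h x (EuclideanSpace.single i 1) := by
    intro x
    have hx := (EuclideanSpace.basisFun (Fin n) ℝ).sum_repr x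
    generalize fderiv ℝ h x = L
    conv_lhs => rw [← hx]
    rw [map_sum]
    simp
  simp_rw [hsum]
  rw [integral_finsetSum _ (fun i _ => hint i)]
  simp [key]

lemma aux_radial {n : ℕ} (r : ℝ) (x : EuclideanSpace ℝ (Fin n)) (hx : x ≠ 0)
    (g : EuclideanSpace ℝ (Fin n) → ℝ) (hg : DifferentiableAt ℝ g x) :
    fderiv ℝ (fun x => g x * ‖x‖ ^ r) x x =
      fderiv ℝ g x x * ‖x‖ ^ r + r * (g x * ‖x‖ ^ r) := by
  have hn : 0 < ‖x‖ := norm_pos_iff.mpr hx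
  have hd : DifferentiableAt ℝ (fun y : EuclideanSpace ℝ (Fin n) => ‖y‖) x :=
    (contDiffAt_norm ℝ hx (n := 1)).differentiableAt one_ne_zero
  have h1 := hd.hasFDerivAt.rpow_const (p := r) (Or.inl hn.ne')
  have h2 := hg.hasFDerivAt.mul h1
  have h3 := hd.fderiv_norm_self
  have h4 : fderiv ℝ (fun x => g x * ‖x‖ ^ r) x = _ := h2.fderiv
  rw [h4]
  simp [h3]
  have : ‖x‖ ^ r = ‖x‖ ^ (r - 1) * ‖x‖ := by
    rw [← rpow_add_one hn.ne']; simp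
  rw [this]
  ring

theorem stmt7 (n : ℕ) (hn : 1 ≤ n) (p α : ℝ) (hp1 : 1 < p)
    (hα : α ≠ (n : ℝ) / p - 1)
    (f : EuclideanSpace ℝ (Fin n) → ℂ)
    (hf : ContDiff ℝ (⊤ : ℕ∞) f) (hsupp : HasCompactSupport f)
    (h0 : (0 : EuclideanSpace ℝ (Fin n)) ∉ tsupport f) :
    (∫ x, ‖f x‖ ^ p / ‖x‖ ^ ((α + 1) * p)) ^ (1 / p) ≤
      p / |(n : ℝ) - p * (α + 1)| *
        (∫ x, ‖fderiv ℝ f x‖ ^ p / ‖x‖ ^ (α * p)) ^ (1 / p) := by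
  have hp0 : 0 < p := by linarith
  have hc : (n : ℝ) - p * (α + 1) ≠ 0 := by
    intro h
    apply hα
    field_simp
    linarith
  have hf1 : ContDiff ℝ 1 f := hf.of_le (by exact_mod_cast le_top)
  have hfd : Differentiable ℝ f := hf1.differentiable one_ne_zero
  have hcd : Continuous (fderiv ℝ f) := hf1.continuous_fderiv one_ne_zero
  have h0' : (0 : EuclideanSpace ℝ (Fin n)) ∉ tsupport (fderiv ℝ f) :=
    fun h => h0 (tsupport_fderiv_subset ℝ h)
  have hf0 : f 0 = 0 := image_eq_zero_of_notMem_tsupport h0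
  have hf0' : fderiv ℝ f 0 = 0 := image_eq_zero_of_notMem_tsupport h0'
  -- the basic functions
  set u : EuclideanSpace ℝ (Fin n) → ℝ := fun x => ‖f x‖ * ‖x‖ ^ (-(α + 1)) with hu
  set B : EuclideanSpace ℝ (Fin n) → ℝ := fun x => ‖fderiv ℝ f x‖ * ‖x‖ ^ (-α) with hB
  set g : EuclideanSpace ℝ (Fin n) → ℝ := fun x => ‖f x‖ ^ p with hg
  have hu0 : ∀ x, 0 ≤ u x := fun x => by positivity
  have hB0 : ∀ x, 0 ≤ B x := fun x => by positivity
  have huc : Continuous u := by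
    apply aux_continuous _ _ hf.continuous.norm
    exact fun h => h0 (tsupport_comp_subset (g := fun z : ℂ => ‖z‖) norm_zero f h)
  have hBc : Continuous B := by
    apply aux_continuous _ _ hcd.norm
    exact fun h => h0' (tsupport_comp_subset
      (g := fun z : EuclideanSpace ℝ (Fin n) →L[ℝ] ℂ => ‖z‖) norm_zero _ h)
  have hus : HasCompactSupport u := hsupp.norm.mul_right
  have hBs : HasCompactSupport B := (hsupp.fderiv ℝ).norm.mul_right
  have hgC : ContDiff ℝ 1 g := hf1.norm_rpow hp1
  have hz : (fun z : ℂ => ‖z‖ ^ p) 0 = 0 := by simp [hp0.ne']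
  have hgs : HasCompactSupport g := hsupp.comp_left (g := fun z : ℂ => ‖z‖ ^ p) hz
  have hg0 : (0 : EuclideanSpace ℝ (Fin n)) ∉ tsupport g :=
    fun h => h0 (tsupport_comp_subset (g := fun z : ℂ => ‖z‖ ^ p) hz f h)
  set s : ℝ := (α + 1) * p with hs
  set h : EuclideanSpace ℝ (Fin n) → ℝ := fun x => g x * ‖x‖ ^ (-s) with hh
  have hhC : ContDiff ℝ 1 h := aux_contDiff_s7 _ _ hgC hg0
  have hhs : HasCompactSupport h := hgs.mul_right
  have hhu : ∀ x, h x = u x ^ p := by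
    intro x
    simp only [hh, hg, hu]
    rw [mul_rpow (norm_nonneg _) (by positivity), ← rpow_mul (norm_nonneg _)]
    congr 2
    rw [hs]; ring
  have hI : ∫ x, ‖f x‖ ^ p / ‖x‖ ^ s = ∫ x, u x ^ p := by
    congr 1; ext x
    rw [← hhu]
    simp only [hh, hg]
    rw [rpow_neg (norm_nonneg _), div_eq_mul_inv]
  have hJ : ∫ x, ‖fderiv ℝ f x‖ ^ p / ‖x‖ ^ (α * p) = ∫ x, B x ^ p := by
    congr 1; ext x
    simp only [hB]
    rw [mul_rpow (norm_nonneg _) (by positivity), ← rpow_mul (norm_nonneg _), neg_mul,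
      rpow_neg (norm_nonneg _), div_eq_mul_inv]
  rw [hI, hJ]
  set I := ∫ x, u x ^ p with hIdef
  set J := ∫ x, B x ^ p with hJdef
  have hI0 : 0 ≤ I := integral_nonneg fun x => rpow_nonneg (hu0 x) _
  have hJ0 : 0 ≤ J := integral_nonneg fun x => rpow_nonneg (hB0 x) _
  have hhint : Integrable h := hhC.continuous.integrable_of_hasCompactSupport hhs
  have hhI : ∫ x, h x = I := by simp_rw [hhu]; rfl
  have heul := aux_euler_s7 h hhC hhs
  rw [hhI] at heul
  -- pointwise identity
  have hdint : Integrable (fun x => fderiv ℝ h x x) := by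
    have : Continuous (fderiv ℝ h) := hhC.continuous_fderiv one_ne_zero
    apply Continuous.integrable_of_hasCompactSupport
    · fun_prop
    · refine (hhs.fderiv ℝ).mono ?_
      intro x hx hx'
      apply hx
      simp [hx']
  have hADint : ∫ x, (fderiv ℝ h x x + s * h x) = -((n : ℝ) - p * (α + 1)) * I := by
    rw [integral_add hdint (hhint.const_mul s), integral_const_mul, heul, hhI, hs]
    ring
  have hq : p.HolderConjugate (p / (p - 1)) := Real.HolderConjugate.conjExponent hp1
  have hAc : Continuous (fun x => u x ^ (p - 1)) :=
    huc.rpow_const (fun x => Or.inr (by linarith))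
  have hAs : HasCompactSupport (fun x => u x ^ (p - 1)) :=
    hus.comp_left (g := fun t : ℝ => t ^ (p - 1)) (zero_rpow (by linarith))
  have hbound : ∀ x, ‖fderiv ℝ h x x + s * h x‖ ≤ p * (u x ^ (p - 1) * B x) := by
    intro x
    by_cases hx : x = 0
    · subst hx
      have : h 0 = 0 := by simp [hh, hg, hf0, hp0.ne']
      rw [map_zero, this]
      simp only [mul_zero, add_zero, norm_zero]
      exact mul_nonneg hp0.le (mul_nonneg (rpow_nonneg (hu0 _) _) (hB0 _))
    · have hxn : 0 < ‖x‖ := norm_pos_iff.mpr hx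
      have e := aux_radial (-s) x hx g (hgC.differentiable one_ne_zero x)
      have e2 : fderiv ℝ h x x + s * h x = fderiv ℝ g x x * ‖x‖ ^ (-s) := by
        rw [hh, e]; ring
      rw [e2, norm_mul, norm_of_nonneg (rpow_nonneg (norm_nonneg x) (-s))]
      have b1 : ‖fderiv ℝ g x x‖ ≤ p * ‖f x‖ ^ (p - 1) * ‖fderiv ℝ f x‖ * ‖x‖ :=
        ((fderiv ℝ g x).le_opNorm x).trans
          (mul_le_mul_of_nonneg_right (norm_fderiv_norm_rpow_le hfd hp1) (norm_nonneg _))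
      refine (mul_le_mul_of_nonneg_right b1 (by positivity)).trans (le_of_eq ?_)
      simp only [hu, hB]
      rw [mul_rpow (norm_nonneg _) (by positivity), ← rpow_mul (norm_nonneg _)]
      have e3 : ‖x‖ * ‖x‖ ^ (-s) = ‖x‖ ^ (-(α + 1) * (p - 1)) * ‖x‖ ^ (-α) := by
        rw [← rpow_add hxn, mul_comm, ← rpow_add_one hxn.ne']
        congr 1
        rw [hs]; ring
      calc _ = p * ‖f x‖ ^ (p - 1) * ‖fderiv ℝ f x‖ * (‖x‖ * ‖x‖ ^ (-s)) := by ring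
        _ = _ := by rw [e3]; ring
  have hABint : Integrable (fun x => u x ^ (p - 1) * B x) :=
    (hAc.mul hBc).integrable_of_hasCompactSupport hBs.mul_left
  have hhold : ∫ x, u x ^ (p - 1) * B x ≤ I ^ (1 / (p / (p - 1))) * J ^ (1 / p) := by
    have := integral_mul_le_Lp_mul_Lq_of_nonneg (μ := (volume : Measure (EuclideanSpace ℝ (Fin n))))
      hq.symm (f := fun x => u x ^ (p - 1)) (g := B)
      (ae_of_all _ fun x => rpow_nonneg (hu0 x) _) (ae_of_all _ hB0)
      (hAc.memLp_of_hasCompactSupport hAs) (hBc.memLp_of_hasCompactSupport hBs)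
    convert this using 3
    rw [hIdef]
    congr 1; ext x
    rw [← rpow_mul (hu0 x)]
    congr 1
    have : p - 1 ≠ 0 := by linarith
    field_simp
  have hmain : |(n : ℝ) - p * (α + 1)| * I ≤ p * (I ^ (1 / (p / (p - 1))) * J ^ (1 / p)) := by
    calc |(n : ℝ) - p * (α + 1)| * I = ‖∫ x, (fderiv ℝ h x x + s * h x)‖ := by
          rw [hADint, norm_mul, norm_neg, norm_eq_abs, norm_of_nonneg hI0]
      _ ≤ ∫ x, p * (u x ^ (p - 1) * B x) :=
          norm_integral_le_of_norm_le (hABint.const_mul p) (ae_of_all _ hbound)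
      _ = p * ∫ x, u x ^ (p - 1) * B x := integral_const_mul _ _
      _ ≤ _ := mul_le_mul_of_nonneg_left hhold hp0.le
  have hcp : 0 < |(n : ℝ) - p * (α + 1)| := abs_pos.mpr hc
  rcases hI0.eq_or_lt with hI' | hI'
  · rw [← hI', zero_rpow (by positivity)]
    positivity
  · have hsplit : I = I ^ (1 / (p / (p - 1))) * I ^ (1 / p) := by
      rw [← rpow_add hI']
      have : 1 / (p / (p - 1)) + 1 / p = 1 := by
        have : p - 1 ≠ 0 := by linarith
        field_simp
        ring
      rw [this, rpow_one]
    have hpos : 0 < I ^ (1 / (p / (p - 1))) := rpow_pos_of_pos hI' _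
    rw [div_mul_eq_mul_div, le_div_iff₀ hcp]
    refine le_of_mul_le_mul_left ?_ hpos
    calc _ = |(n : ℝ) - p * (α + 1)| * (I ^ (1 / (p / (p - 1))) * I ^ (1 / p)) := by ring
      _ = |(n : ℝ) - p * (α + 1)| * I := by rw [← hsplit]
      _ ≤ _ := hmain
      _ = _ := by ring
end

section
/- Let $n \ge 2$, $1 < p < \infty$. For all $f \in C_0^\infty(\mathbb{R}^n \setminus \{0\})$ and all $R > 0$, $$\left\|\frac{f - f_R}{\|x\|^{n/p} \log\frac{R}{\|x\|}}\right\|_{L^p(\mathbb{R}^n)} \le \frac{p}{p-1} \left\|\frac{1}{\|x\|^{n/p - 1}}\, \frac{x}{\|x\|}\cdot\nabla f\right\|_{L^p(\mathbb{R}^n)},$$ where $f_R(x) = f\left(R \frac{x}{\|x\|}\right)$. -/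
open MeasureTheory Real Finset

theorem aux_pow (p : ℝ) (hp1 : 1 < p) :
    ∫⁻ l in Set.Ioo (0:ℝ) 1, ENNReal.ofReal (l ^ (-(1/p))) = ENNReal.ofReal (p/(p-1)) := by
  have hlt : 1/p < 1 := by rw [div_lt_one (by linarith)]; exact hp1
  have hint : IntervalIntegrable (fun l : ℝ => l ^ (-(1/p))) volume 0 1 :=
    intervalIntegral.intervalIntegrable_rpow' (by linarith)
  rw [restrict_Ioo_eq_restrict_Ioc, ← ofReal_integral_eq_lintegral_ofReal, ← intervalIntegral.integral_of_le zero_le_one,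
    integral_rpow (Or.inl (by linarith))]
  · congr 1
    have : p ≠ 0 := by linarith
    have h3 : p - 1 ≠ 0 := by linarith
    have h4 : -(1/p) + 1 ≠ 0 := by linarith
    rw [Real.one_rpow, Real.zero_rpow h4]
    have h5 : -(1/p) + 1 = (p-1)/p := by field_simp; ring
    rw [h5, sub_zero, one_div_div]
  · exact hint.1
  · filter_upwards [ae_restrict_mem measurableSet_Ioc] with y hy
    exact Real.rpow_nonneg hy.1.le _

theorem aux_scale (g : ℝ → ENNReal) (l : ℝ) (hl : 0 < l) :
    ∫⁻ s, g (l * s) = ENNReal.ofReal (l⁻¹) * ∫⁻ s, g s := by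
  have h := lintegral_image_eq_lintegral_abs_deriv_mul (s := Set.univ) (f := fun s : ℝ => l * s)
    (f' := fun _ => l) MeasurableSet.univ
    (fun x _ => by simpa using ((hasDerivAt_id x).const_mul l))
    (fun a _ b _ h => by simpa [hl.ne'] using h) g
  have him : (fun s : ℝ => l * s) '' Set.univ = Set.univ := by
    rw [Set.image_univ]
    exact (mul_left_surjective₀ hl.ne').range_eq
  rw [him] at h
  simp only [Measure.restrict_univ] at h
  rw [h, lintegral_const_mul' _ _ ENNReal.ofReal_ne_top, ← mul_assoc, abs_of_pos hl,
    ← ENNReal.ofReal_mul (by positivity), inv_mul_cancel₀ hl.ne', ENNReal.ofReal_one, one_mul]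

theorem aux_hardy (p : ℝ) (hp1 : 1 < p) (g : ℝ → ENNReal) (hg : Measurable g) :
    ∫⁻ s, (∫⁻ l in Set.Ioo (0:ℝ) 1, g (l * s)) ^ p ≤
      ENNReal.ofReal (p/(p-1)) ^ p * ∫⁻ s, g s ^ p := by
  have hp0 : 0 < p := by linarith
  have hpm : 0 < p - 1 := by linarith
  set q := p / (p-1) with hq
  have hq0 : 0 < q := by positivity
  have hpq : p.HolderConjugate q := Real.HolderConjugate.conjExponent hp1
  have hsum := hpq.inv_add_inv_eq_one
  have key : ∀ s, (∫⁻ l in Set.Ioo (0:ℝ) 1, g (l * s)) ^ p ≤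
      ENNReal.ofReal q ^ (p/q) * ∫⁻ l in Set.Ioo (0:ℝ) 1, ENNReal.ofReal (l ^ (1/q)) * g (l*s) ^ p := by
    intro s
    have h := ENNReal.lintegral_mul_le_Lp_mul_Lq (volume.restrict (Set.Ioo (0:ℝ) 1)) hpq
      (f := fun l => ENNReal.ofReal (l ^ (1/(q*p))) * g (l*s))
      (g := fun l => ENNReal.ofReal (l ^ (-(1/(q*p)))))
      (by fun_prop) (by fun_prop)
    have e1 : ∫⁻ l in Set.Ioo (0:ℝ) 1, ((fun l => ENNReal.ofReal (l ^ (1/(q*p))) * g (l*s)) *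
        (fun l => ENNReal.ofReal (l ^ (-(1/(q*p)))))) l = ∫⁻ l in Set.Ioo (0:ℝ) 1, g (l * s) := by
      refine setLIntegral_congr_fun measurableSet_Ioo fun l hl => ?_
      have hl0 : 0 < l := hl.1
      simp only [Pi.mul_apply]
      rw [mul_right_comm, ← ENNReal.ofReal_mul (by positivity), ← Real.rpow_add hl0]
      simp
    have e2 : ∫⁻ l in Set.Ioo (0:ℝ) 1, (fun l => ENNReal.ofReal (l ^ (1/(q*p))) * g (l*s)) l ^ p
        = ∫⁻ l in Set.Ioo (0:ℝ) 1, ENNReal.ofReal (l ^ (1/q)) * g (l*s) ^ p := by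
      refine setLIntegral_congr_fun measurableSet_Ioo fun l hl => ?_
      have hl0 : 0 < l := hl.1
      simp only
      rw [ENNReal.mul_rpow_of_nonneg _ _ hp0.le, ENNReal.ofReal_rpow_of_nonneg (by positivity) hp0.le,
        ← Real.rpow_mul hl0.le]
      congr 3
      field_simp
    have e3 : ∫⁻ l in Set.Ioo (0:ℝ) 1, (fun l : ℝ => ENNReal.ofReal (l ^ (-(1/(q*p))))) l ^ q
        = ENNReal.ofReal q := by
      rw [hq, ← aux_pow p hp1, ← hq]
      refine setLIntegral_congr_fun measurableSet_Ioo fun l hl => ?_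
      have hl0 : 0 < l := hl.1
      simp only
      rw [ENNReal.ofReal_rpow_of_nonneg (by positivity) hq0.le,
        ← Real.rpow_mul hl0.le]
      congr 2
      field_simp
    rw [e1, e2, e3] at h
    calc _ ≤ _ := ENNReal.rpow_le_rpow h hp0.le
      _ = _ := by
        rw [ENNReal.mul_rpow_of_nonneg _ _ hp0.le, ← ENNReal.rpow_mul, ← ENNReal.rpow_mul,
          one_div_mul_cancel hp0.ne', ENNReal.rpow_one, mul_comm]
        congr 2
        ring
  calc _ ≤ _ := lintegral_mono key
    _ = ENNReal.ofReal q ^ (p/q) * ∫⁻ l in Set.Ioo (0:ℝ) 1, ∫⁻ s, ENNReal.ofReal (l ^ (1/q)) * g (l*s) ^ p := by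
      rw [lintegral_const_mul' _ _ (ENNReal.rpow_ne_top_of_nonneg (by positivity) ENNReal.ofReal_ne_top)]
      rw [lintegral_lintegral_swap]
      apply Measurable.aemeasurable
      unfold Function.uncurry
      fun_prop
    _ = ENNReal.ofReal q ^ (p/q) * ∫⁻ l in Set.Ioo (0:ℝ) 1, ENNReal.ofReal (l ^ (-(1/p))) * ∫⁻ s, g s ^ p := by
      congr 1
      refine setLIntegral_congr_fun measurableSet_Ioo fun l hl => ?_
      have hl0 : 0 < l := hl.1
      rw [lintegral_const_mul' _ _ ENNReal.ofReal_ne_top, aux_scale (fun s => g s ^ p) l hl0, ← mul_assoc,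
        ← ENNReal.ofReal_mul (by positivity), ← Real.rpow_neg_one, ← Real.rpow_add hl0]
      congr 3
      simp only [one_div]
      linarith
    _ = _ := by
      rw [lintegral_mul_const _ (by fun_prop), aux_pow p hp1, ← hq, ← mul_assoc]
      congr 1
      nth_rw 2 [← ENNReal.rpow_one (ENNReal.ofReal q)]
      rw [← ENNReal.rpow_add _ _ (by simpa using hq0) ENNReal.ofReal_ne_top]
      congr 1
      rw [hq]; field_simp; ring

theorem aux_hardy1 (p : ℝ) (hp1 : 1 < p) (u u' : ℝ → ℂ) (hu : ∀ s, HasDerivAt u (u' s) s)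
    (hu' : Continuous u') (s0 : ℝ) :
    ∫⁻ s, (‖u s - u s0‖ₑ / ‖s - s0‖ₑ) ^ p ≤
      ENNReal.ofReal (p/(p-1)) ^ p * ∫⁻ s, ‖u' s‖ₑ ^ p := by
  have h := aux_hardy p hp1 (fun s => ‖u' (s + s0)‖ₑ) (by have := hu'.measurable; fun_prop)
  rw [lintegral_add_right_eq_self (fun s => ‖u' s‖ₑ ^ p) s0] at h
  rw [← lintegral_add_right_eq_self (fun s => (‖u s - u s0‖ₑ / ‖s - s0‖ₑ) ^ p) s0]
  refine le_trans (lintegral_mono fun s => ?_) h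
  refine ENNReal.rpow_le_rpow ?_ (by linarith)
  simp only [add_sub_cancel_right]
  by_cases hs : s = 0
  · simp [hs]
  rw [ENNReal.div_le_iff (by simpa using hs) (by simp)]
  have hd : ∀ l : ℝ, HasDerivAt (fun l => u (l * s + s0)) (s • u' (l * s + s0)) l := by
    intro l
    refine HasDerivAt.scomp l (hu (l * s + s0)) ?_
    simpa using ((hasDerivAt_id l).mul_const s).add_const s0
  have hI := intervalIntegral.integral_eq_sub_of_hasDerivAt (a := 0) (b := 1) (fun l _ => hd l)
    (Continuous.intervalIntegrable (by fun_prop) _ _)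
  rw [intervalIntegral.integral_smul] at hI
  simp only [one_mul, zero_mul, zero_add] at hI
  rw [← hI, enorm_smul, mul_comm, intervalIntegral.integral_of_le zero_le_one,
    ← restrict_Ioo_eq_restrict_Ioc]
  gcongr
  exact enorm_integral_le_lintegral_enorm _

theorem aux_exp (g : ℝ → ENNReal) :
    ∫⁻ r in Set.Ioi (0:ℝ), g r = ∫⁻ s, ENNReal.ofReal (Real.exp s) * g (Real.exp s) := by
  have h := lintegral_image_eq_lintegral_abs_deriv_mul (s := Set.univ) (f := Real.exp)
    (f' := Real.exp) MeasurableSet.univ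
    (fun x _ => (Real.hasDerivAt_exp x).hasDerivWithinAt) Real.exp_injective.injOn g
  rw [Set.image_univ, Real.range_exp] at h
  simpa using h

theorem aux_polar (n : ℕ) (hn : 1 ≤ n) (H : EuclideanSpace ℝ (Fin n) → ENNReal) (hH : Measurable H) :
    ∫⁻ x, H x = ∫⁻ w, ∫⁻ s : ℝ, ENNReal.ofReal (Real.exp s ^ n) * H (Real.exp s • w.1)
      ∂volume ∂(volume : Measure (EuclideanSpace ℝ (Fin n))).toSphere := by
  have : Nonempty (Fin n) := ⟨⟨0, hn⟩⟩
  have hmp := (volume : Measure (EuclideanSpace ℝ (Fin n))).measurePreserving_homeomorphUnitSphereProd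
  have h1 : ∫⁻ x, H x = ∫⁻ x : ({0}ᶜ : Set (EuclideanSpace ℝ (Fin n))), H x.1 ∂(volume.comap Subtype.val) := by
    rw [lintegral_subtype_comap (measurableSet_singleton _).compl, restrict_compl_singleton]
  have h2 := (MeasurePreserving.symm (homeomorphUnitSphereProd (EuclideanSpace ℝ (Fin n))).toMeasurableEquiv hmp).lintegral_comp (f := fun x => H x.1) (hH.comp measurable_subtype_coe)
  rw [h1, ← h2, lintegral_prod]
  · refine lintegral_congr fun w => ?_
    rw [Measure.volumeIoiPow, lintegral_withDensity_eq_lintegral_mul]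
    · have := lintegral_subtype_comap (μ := volume) (measurableSet_Ioi (a := (0:ℝ))) (fun r => ENNReal.ofReal (r ^ (n-1)) * H (r • w.1))
      rw [aux_exp] at this
      simp only [finrank_euclideanSpace, Fintype.card_fin, Pi.mul_apply]
      refine Eq.trans ?_ (this.trans ?_)
      · rfl
      · refine lintegral_congr fun s => ?_
        rw [← mul_assoc, ← ENNReal.ofReal_mul (by positivity), ← pow_succ', Nat.sub_add_cancel hn]
    · fun_prop
    · exact hH.comp (measurable_subtype_coe.comp ((homeomorphUnitSphereProd _).symm.continuous.measurable.comp measurable_prodMk_left))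
  · exact (hH.comp (measurable_subtype_coe.comp (homeomorphUnitSphereProd _).symm.continuous.measurable)).aemeasurable

theorem stmt17 (n : ℕ) (hn : 2 ≤ n) (p : ℝ) (hp1 : 1 < p)
    (f : EuclideanSpace ℝ (Fin n) → ℂ)
    (hf : ContDiff ℝ (⊤ : ℕ∞) f) (hsupp : HasCompactSupport f)
    (h0 : (0 : EuclideanSpace ℝ (Fin n)) ∉ tsupport f)
    (R : ℝ) (hR : 0 < R) :
    (∫ x, ‖f x - f ((R / ‖x‖) • x)‖ ^ p /
        (‖x‖ ^ (n : ℝ) * |Real.log (R / ‖x‖)| ^ p)) ^ (1 / p) ≤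
      p / (p - 1) *
        (∫ x, ‖Rop f x‖ ^ p / ‖x‖ ^ ((n : ℝ) - p)) ^ (1 / p) := by
  have hp0 : 0 < p := by linarith
  have hpm : 0 < p - 1 := by linarith
  have hfm : Measurable f := hf.continuous.measurable
  have hfd : Continuous (fun x => fderiv ℝ f x) := hf.continuous_fderiv (by simp)
  have hfx : Continuous (fun x => fderiv ℝ f x x) := hfd.clm_apply continuous_id
  have hfxm := hfx.measurable
  have hRm : Measurable (Rop f) := by unfold Rop; fun_prop
  have hLm : Measurable (fun x => ‖f x - f ((R / ‖x‖) • x)‖ ^ p /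
        (‖x‖ ^ (n : ℝ) * |Real.log (R / ‖x‖)| ^ p)) := by
    have h1 : Measurable (fun x : EuclideanSpace ℝ (Fin n) => f ((R / ‖x‖) • x)) :=
      hfm.comp (by fun_prop)
    have h2 : Measurable (fun x : EuclideanSpace ℝ (Fin n) => |Real.log (R / ‖x‖)|) :=
      continuous_abs.measurable.comp (Real.measurable_log.comp (by fun_prop))
    fun_prop
  have hGm : Measurable (fun x => ‖Rop f x‖ ^ p / ‖x‖ ^ ((n : ℝ) - p)) := by fun_prop
  have hint : Integrable (fun x => ‖Rop f x‖ ^ p / ‖x‖ ^ ((n : ℝ) - p)) := by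
    have hss : Function.support (fun x => ‖Rop f x‖ ^ p / ‖x‖ ^ ((n : ℝ) - p)) ⊆ tsupport f := by
      intro x hx
      by_contra hxs
      apply hx
      have : fderiv ℝ f x = 0 := by
        have := support_fderiv_subset ℝ (f := f)
        by_contra h
        exact hxs (this h)
      simp [Rop, this, Real.zero_rpow hp0.ne']
    rw [← integrableOn_iff_integrable_of_support_subset hss]
    refine ContinuousOn.integrableOn_compact hsupp ?_
    have hne : ∀ x ∈ tsupport f, ‖x‖ ≠ 0 := by
      intro x hx h
      rw [norm_eq_zero] at h
      exact h0 (h ▸ hx)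
    have hc : ContinuousOn (Rop f) (tsupport f) :=
      (continuous_norm.continuousOn.inv₀ hne).smul hfx.continuousOn
    refine ContinuousOn.div (hc.norm.rpow_const fun x _ => Or.inr hp0.le)
      (continuous_norm.continuousOn.rpow_const fun x hx => Or.inl (hne x hx)) fun x hx => ?_
    have := hne x hx
    positivity
  have main : ∫⁻ x, ENNReal.ofReal (‖f x - f ((R / ‖x‖) • x)‖ ^ p /
        (‖x‖ ^ (n : ℝ) * |Real.log (R / ‖x‖)| ^ p)) ≤ ENNReal.ofReal (p/(p-1)) ^ p *
      ∫⁻ x, ENNReal.ofReal (‖Rop f x‖ ^ p / ‖x‖ ^ ((n : ℝ) - p)) := by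
    rw [aux_polar n (by omega) _ hLm.ennreal_ofReal, aux_polar n (by omega) _ hGm.ennreal_ofReal,
      ← lintegral_const_mul' _ _ (ENNReal.rpow_ne_top_of_nonneg hp0.le ENNReal.ofReal_ne_top)]
    refine lintegral_mono fun w => ?_
    have hw : ‖w.1‖ = 1 := by simp
    have hnorm : ∀ s : ℝ, ‖Real.exp s • w.1‖ = Real.exp s := by
      intro s; rw [norm_smul, hw, mul_one, Real.norm_eq_abs, abs_of_pos (Real.exp_pos s)]
    have hder : ∀ s : ℝ, HasDerivAt (fun s => f (Real.exp s • w.1))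
        (fderiv ℝ f (Real.exp s • w.1) (Real.exp s • w.1)) s := by
      intro s
      have hd : DifferentiableAt ℝ f (Real.exp s • w.1) := (hf.differentiable (by simp)) _
      exact hd.hasFDerivAt.comp_hasDerivAt s ((Real.hasDerivAt_exp s).smul_const w.1)
    have h := aux_hardy1 p hp1 _ _ hder (hfx.comp (by fun_prop)) (Real.log R)
    refine le_trans (le_of_eq ?_) (h.trans (le_of_eq ?_))
    · refine lintegral_congr fun s => ?_
      have hes := Real.exp_pos s
      simp only [hnorm]
      rw [Real.exp_log hR, smul_smul, div_mul_cancel₀ _ hes.ne', Real.log_div hR.ne' hes.ne', Real.log_exp,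
        ← ENNReal.ofReal_mul (by positivity)]
      by_cases hs : s = Real.log R
      · subst hs
        simp [Real.exp_log hR, hp0, Real.zero_rpow hp0.ne']
      have hs' : 0 < |s - Real.log R| := abs_pos.2 (sub_ne_zero.2 hs)
      rw [← ofReal_norm, ← ofReal_norm, Real.norm_eq_abs, ← ENNReal.ofReal_div_of_pos hs',
        ENNReal.ofReal_rpow_of_nonneg (by positivity) hp0.le, Real.div_rpow (by positivity) (by positivity),
        abs_sub_comm, Real.rpow_natCast]
      congr 1
      field_simp
    · congr 1
      refine lintegral_congr fun s => ?_
      have hes := Real.exp_pos s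
      simp only [Rop, hnorm]
      rw [← ENNReal.ofReal_mul (by positivity), ← ofReal_norm,
        ENNReal.ofReal_rpow_of_nonneg (by positivity) hp0.le, norm_smul, norm_inv, Real.norm_eq_abs, abs_of_pos hes,
        Real.mul_rpow (by positivity) (by positivity), Real.rpow_sub hes, Real.rpow_natCast, Real.inv_rpow hes.le]
      congr 1
      field_simp
  have hnonL : ∀ x, 0 ≤ ‖f x - f ((R / ‖x‖) • x)‖ ^ p /
        (‖x‖ ^ (n : ℝ) * |Real.log (R / ‖x‖)| ^ p) := fun x => by positivity
  have hnonG : ∀ x, 0 ≤ ‖Rop f x‖ ^ p / ‖x‖ ^ ((n : ℝ) - p) := fun x => by positivity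
  rw [← ofReal_integral_eq_lintegral_ofReal hint (Filter.Eventually.of_forall hnonG),
    ENNReal.ofReal_rpow_of_nonneg (by positivity) hp0.le, ← ENNReal.ofReal_mul (by positivity)] at main
  have hG0 := integral_nonneg (μ := volume) (f := fun x => ‖Rop f x‖ ^ p / ‖x‖ ^ ((n : ℝ) - p)) hnonG
  have m2 : (∫ x, ‖f x - f ((R / ‖x‖) • x)‖ ^ p /
        (‖x‖ ^ (n : ℝ) * |Real.log (R / ‖x‖)| ^ p)) ≤ (p/(p-1)) ^ p *
      ∫ x, ‖Rop f x‖ ^ p / ‖x‖ ^ ((n : ℝ) - p) := by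
    rw [integral_eq_lintegral_of_nonneg_ae (Filter.Eventually.of_forall hnonL) hLm.aestronglyMeasurable]
    exact ENNReal.toReal_le_of_le_ofReal (mul_nonneg (by positivity) hG0) main
  calc _ ≤ _ := Real.rpow_le_rpow (integral_nonneg hnonL) m2 (by positivity)
    _ = _ := by
      rw [Real.mul_rpow (by positivity) hG0, ← Real.rpow_mul (by positivity), mul_one_div_cancel hp0.ne', Real.rpow_one]
end
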